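/- Let (J,R,Q,G,F,S,N) be pH plant data of state dimension n and port dimension m, and (J_K,R_K,Q_K,G_K,F_K,S_K,N_K) be pH controller data of state dimension k and port dimension m, and assume the well-posedness matrix Z₀ = [[I_m, S_K−N_K],[−(S−N), I_m]] is invertible. Let A_cl be the negative-feedback closed-loop matrix and let 𝒬₂ = diag(Q, Q_K) ∈ ℝ^{(n+k)×(n+k)}. Then 𝒬₂A_cl + A_clᵀ𝒬₂ is negative semidefinite; equivalently, the combined Hamiltonian H(x) + H_K(x_K) = ½xᵀQx + ½x_KᵀQ_Kx_K is nonincreasing along trajectories of the autonomous closed-loop system. -/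

import Mathlib

open Matrix

/-- A skew-symmetric real matrix has vanishing quadratic form. -/
theorem dotProduct_mulVec_self_eq_zero_of_transpose_eq_neg {ι : Type*} [Fintype ι]
    {A : Matrix ι ι ℝ} (hA : Aᵀ = -A) (v : ι → ℝ) : v ⬝ᵥ A *ᵥ v = 0 := by
  have h : v ⬝ᵥ A *ᵥ v = v ⬝ᵥ Aᵀ *ᵥ v := by
    rw [mulVec_transpose, dotProduct_comm v (v ᵥ* A), dotProduct_mulVec]
  rw [hA, neg_mulVec, dotProduct_neg] at h
  linarith

/-- Dissipation inequality of a port-Hamiltonian system with effort `z` and input `u`: the rate of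
change of the Hamiltonian is at most the supplied power. -/
theorem portHamiltonian_power_le_supply {ι κ : Type*} [Fintype ι] [Fintype κ]
    {J R : Matrix ι ι ℝ} {G F : Matrix ι κ ℝ} {S N : Matrix κ κ ℝ}
    (hJ : Jᵀ = -J) (hN : Nᵀ = -N) (hW : (fromBlocks R F Fᵀ S).PosSemidef)
    (z : ι → ℝ) (u : κ → ℝ) :
    z ⬝ᵥ ((J - R) *ᵥ z + (G - F) *ᵥ u) ≤ u ⬝ᵥ ((G + F)ᵀ *ᵥ z + (S - N) *ᵥ u) := by
  have hJz := dotProduct_mulVec_self_eq_zero_of_transpose_eq_neg hJ z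
  have hNu := dotProduct_mulVec_self_eq_zero_of_transpose_eq_neg hN u
  have h := hW.dotProduct_mulVec_nonneg (Sum.elim z u)
  rw [star_trivial, fromBlocks_mulVec] at h
  have transpose_form (A : Matrix ι κ ℝ) : u ⬝ᵥ Aᵀ *ᵥ z = z ⬝ᵥ A *ᵥ u := by
    rw [mulVec_transpose, dotProduct_comm, dotProduct_mulVec]
  simp only [Sum.elim_comp_inl, Sum.elim_comp_inr, sumElim_dotProduct_sumElim, dotProduct_add,
    transpose_form] at h
  simp only [transpose_add, add_mulVec, sub_mulVec, dotProduct_add, dotProduct_sub, transpose_form]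
  linarith

/-- For a well-posed negative-feedback interconnection of a pH plant and a
pH controller, with `𝒬₂ = diag(Q, Q_K)`, the matrix `𝒬₂ A_cl + A_clᵀ 𝒬₂` is negative
semidefinite (the combined Hamiltonian is nonincreasing along closed-loop trajectories). -/
theorem closed_loop_lyapunov_inequality
    (n k m : ℕ)
    (J R Q : Matrix (Fin n) (Fin n) ℝ) (G F : Matrix (Fin n) (Fin m) ℝ)
    (S N : Matrix (Fin m) (Fin m) ℝ)
    (JK RK QK : Matrix (Fin k) (Fin k) ℝ) (GK FK : Matrix (Fin k) (Fin m) ℝ)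
    (SK NK : Matrix (Fin m) (Fin m) ℝ)
    (hJ : Jᵀ = -J) (hN : Nᵀ = -N) (hQ : Q.PosDef)
    (hW : (Matrix.fromBlocks R F Fᵀ S).PosSemidef)
    (hJK : JKᵀ = -JK) (hNK : NKᵀ = -NK) (hQK : QK.PosDef)
    (hWK : (Matrix.fromBlocks RK FK FKᵀ SK).PosSemidef)
    (Z0 : Matrix (Fin m ⊕ Fin m) (Fin m ⊕ Fin m) ℝ)
    (hZ0 : Z0 = Matrix.fromBlocks 1 (SK - NK) (-(S - N)) 1)
    (hZ0inv : IsUnit Z0.det)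
    (Acl : Matrix (Fin n ⊕ Fin k) (Fin n ⊕ Fin k) ℝ)
    (hAcl : Acl =
      Matrix.fromBlocks ((J - R) * Q) 0 0 ((JK - RK) * QK)
      + Matrix.fromBlocks (G - F) 0 0 (-(GK - FK)) * Z0⁻¹
        * Matrix.fromBlocks 0 ((GK + FK)ᵀ * QK) ((G + F)ᵀ * Q) 0)
    (Q2 : Matrix (Fin n ⊕ Fin k) (Fin n ⊕ Fin k) ℝ)
    (hQ2 : Q2 = Matrix.fromBlocks Q 0 0 QK) :
    (-(Q2 * Acl + Aclᵀ * Q2)).PosSemidef := by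
  have hQ2symm : Q2ᵀ = Q2 := by
    have h : Qᵀ = Q := by simpa using hQ.isHermitian.eq
    have hK : QKᵀ = QK := by simpa using hQK.isHermitian.eq
    rw [hQ2, fromBlocks_transpose, h, hK, transpose_zero, transpose_zero]
  refine .of_dotProduct_mulVec_nonneg ?_ fun x => ?_
  · simp [IsHermitian, hQ2symm, add_comm]
  have hform : star x ⬝ᵥ (-(Q2 * Acl + Aclᵀ * Q2)) *ᵥ x = -(2 * (Q2 *ᵥ x ⬝ᵥ Acl *ᵥ x)) := by
    have h₁ : x ⬝ᵥ (Q2 * Acl) *ᵥ x = Q2 *ᵥ x ⬝ᵥ Acl *ᵥ x := by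
      rw [← mulVec_mulVec, dotProduct_mulVec, ← mulVec_transpose, hQ2symm]
    have h₂ : x ⬝ᵥ (Aclᵀ * Q2) *ᵥ x = Q2 *ᵥ x ⬝ᵥ Acl *ᵥ x := by
      rw [← mulVec_mulVec, dotProduct_mulVec, vecMul_transpose, dotProduct_comm]
    rw [star_trivial, neg_mulVec, dotProduct_neg, add_mulVec, dotProduct_add, h₁, h₂, two_mul]
  rw [hform]
  obtain ⟨x₁, x₂, rfl⟩ : ∃ x₁ x₂, x = Sum.elim x₁ x₂ :=
    ⟨x ∘ Sum.inl, x ∘ Sum.inr, (Sum.elim_comp_inl_inr x).symm⟩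
  -- `u` is the plant input and `y` the plant output; the controller input is `-y`.
  obtain ⟨u, y, huy⟩ : ∃ u y, Z0⁻¹ *ᵥ (fromBlocks 0 ((GK + FK)ᵀ * QK) ((G + F)ᵀ * Q) 0 *ᵥ
      Sum.elim x₁ x₂) = Sum.elim u y :=
    ⟨_, _, (Sum.elim_comp_inl_inr _).symm⟩
  have hZ := congrArg (Z0 *ᵥ ·) huy
  simp only [mulVec_mulVec, ← Matrix.mul_assoc, mul_nonsing_inv _ hZ0inv, Matrix.one_mul] at hZ
  rw [hZ0, fromBlocks_mulVec, fromBlocks_mulVec] at hZ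
  simp only [Sum.elim_comp_inl, Sum.elim_comp_inr, zero_mulVec, one_mulVec, zero_add, add_zero,
    ← mulVec_mulVec, Sum.elim_eq_iff, neg_mulVec] at hZ
  obtain ⟨hu, hy⟩ := hZ
  have hplant := portHamiltonian_power_le_supply (G := G) hJ hN hW (Q *ᵥ x₁) u
  have hctrl := portHamiltonian_power_le_supply (G := GK) hJK hNK hWK (QK *ᵥ x₂) (-y)
  rw [hy, neg_add_cancel_comm] at hplant
  rw [hu, mulVec_neg, mulVec_neg, add_neg_cancel_right, neg_dotProduct,
    dotProduct_comm y u] at hctrl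
  rw [hAcl, hQ2, add_mulVec, ← mulVec_mulVec, ← mulVec_mulVec, huy]
  simp only [fromBlocks_mulVec, Sum.elim_comp_inl, Sum.elim_comp_inr, zero_mulVec, zero_add,
    add_zero, ← mulVec_mulVec, neg_mulVec, dotProduct_add, sumElim_dotProduct_sumElim]
  simp only [dotProduct_add] at hplant hctrl
  linarith
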